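/- arXiv:1502.01216 — 2 statements merged into one kernel-verified Lean document; each statement's English description precedes it below -/
import Mathlib

section
/- Suppose a directed tree T ∈ ℛ(μ,d) contains disjoint directed paths (v, m₁, …, m_k, m) and (v′, m₁′, …, m_l′, m) from vertices v, v′ ∈ V to some internal vertex m ∈ M, with 1 ≤ l ≤ k, f_T(v) < f_T(v′), f_T(m₁) = f_T(m₁′), and f_T(m_i) ≤ f_T(m_i′) for i = 2, …, l. Then there exists a directed tree T′ ∈ ℛ(μ,d) such that f(T′) strictly weakly majorizes f(T), i.e., f(T′) ≻^w f(T). -/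
open scoped Classical
noncomputable section

/-- A directed tree on a finite vertex set `V`: each vertex has an outbound arc to its
`parent`, the `root` is a fixed point of `parent` (i.e. has no genuine outbound arc), and
every vertex reaches the root by iterating `parent`. -/
structure DirTree (V : Type) [Fintype V] [DecidableEq V] where
  root : V
  parent : V → V
  parent_root : parent root = root
  reaches : ∀ v, ∃ n, parent^[n] v = root

variable {V : Type} [Fintype V] [DecidableEq V]

namespace DirTree

/-- `u` belongs to the subordinate group of `v`: there is a directed path from `u` to `v`. -/
def Desc (T : DirTree V) (u v : V) : Prop := ∃ n, T.parent^[n] u = v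

/-- The set of vertices with an arc to `v`. -/
def children (T : DirTree V) (v : V) : Finset V :=
  Finset.univ.filter fun u => T.parent u = v ∧ u ≠ v

/-- Weight `f_T(v)` of the subordinate group of `v`. -/
def f (T : DirTree V) (μ : V → ℝ) (v : V) : ℝ :=
  ∑ u ∈ Finset.univ.filter (fun u => T.Desc u v), μ u

/-- Degree of `v` in the underlying undirected tree. -/
def deg (T : DirTree V) (v : V) : ℕ :=
  (T.children v).card + (if v = T.root then 0 else 1)

/-- The underlying undirected tree. -/
def toGraph (T : DirTree V) : SimpleGraph V :=
  SimpleGraph.fromRel fun u v => T.parent u = v ∧ u ≠ v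

/-- The vector (as a multiset, i.e. up to ascending rearrangement) of subordinate
groups' weights of internal non-root vertices. -/
def fvec (T : DirTree V) (μ : V → ℝ) : Multiset ℝ :=
  (Finset.univ.filter fun m => 1 < T.deg m ∧ m ≠ T.root).val.map (T.f μ)

end DirTree

/-- Degree of a vertex in a simple graph. -/
def gdeg (G : SimpleGraph V) (v : V) : ℕ :=
  (Finset.univ.filter fun u => G.Adj v u).card

/-- `⟨μ, d⟩` is a generating tuple: nonnegative weights, degrees at least 1 summing to
`2(|V|-1)`, at least two pendent and at least one internal vertex. -/
structure IsGenTuple (μ : V → ℝ) (d : V → ℕ) : Prop where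
  nonneg : ∀ v, 0 ≤ μ v
  deg_pos : ∀ v, 1 ≤ d v
  sum_deg : ∑ v, d v = 2 * (Fintype.card V - 1)
  two_le_pendent : 2 ≤ (Finset.univ.filter fun v => d v = 1).card
  one_le_internal : 1 ≤ (Finset.univ.filter fun v => 1 < d v).card

/-- Weights are degree-monotone in `⟨μ, d⟩`. -/
def DegMonotone (μ : V → ℝ) (d : V → ℕ) : Prop :=
  (∀ m m', 1 < d m → 1 < d m' → d m < d m' → μ m ≤ μ m') ∧
  ∀ v, d v = 1 → 0 < μ v

/-- `T ∈ ℛ(μ,d)`: directed tree with internal root whose (undirected) degrees match `d`. -/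
def memR (T : DirTree V) (d : V → ℕ) : Prop :=
  1 < d T.root ∧ ∀ v, T.deg v = d v

/-- `G ∈ 𝒯(μ,d)`: `G` is a tree whose degrees match `d`. -/
def memT (G : SimpleGraph V) (d : V → ℕ) : Prop :=
  G.IsTree ∧ ∀ v, gdeg G v = d v

/-- Vertex-weighted Wiener index. -/
def VWWI (μ : V → ℝ) (G : SimpleGraph V) : ℝ :=
  (1 / 2) * ∑ u, ∑ v, μ u * μ v * (G.dist u v : ℝ)

/-- `S = (m, L)` is a minimal star for the state `(U, μ, d)`: the center `m` is an
internal vertex of `U` of least degree among internal vertices of least weight, and the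
`d m - 1` leaves `L` are pendent vertices of `U` of least weights. -/
def IsMinimalStar (U : Finset V) (μ : V → ℝ) (d : V → ℕ) (m : V) (L : Finset V) : Prop :=
  m ∈ U ∧ 1 < d m ∧ L ⊆ U ∧ m ∉ L ∧ L.card = d m - 1 ∧
  (∀ v ∈ L, d v = 1) ∧
  (∀ m' ∈ U, 1 < d m' → μ m ≤ μ m') ∧
  (∀ m' ∈ U, 1 < d m' → μ m' = μ m → d m ≤ d m') ∧
  ∀ u ∈ L, ∀ w ∈ U, d w = 1 → w ∉ L → μ u ≤ μ w

/-- Centers used before step `i` (0-indexed). -/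
def usedCenters {q : ℕ} (c : Fin q → V) (i : ℕ) : Finset V :=
  (Finset.univ.filter fun j : Fin q => (j : ℕ) < i).image c

/-- Vertex set `V_{i+1}` of the state of the Huffman algorithm before (0-indexed) step `i`,
for the candidate Huffman tree `T` with star centers `c`. -/
def stateV (T : DirTree V) {q : ℕ} (c : Fin q → V) (i : ℕ) : Finset V :=
  Finset.univ \ (Finset.univ.filter fun j : Fin q => (j : ℕ) < i).biUnion fun j => T.children (c j)

/-- Weight function `μ^{i+1}` of the state before (0-indexed) step `i`. -/
def stateMu (T : DirTree V) (μ : V → ℝ) {q : ℕ} (c : Fin q → V) (i : ℕ) : V → ℝ :=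
  fun v => if v ∈ usedCenters c i then T.f μ v else μ v

/-- Degree function `d^{i+1}` of the state before (0-indexed) step `i`. -/
def stateD (d : V → ℕ) {q : ℕ} (c : Fin q → V) (i : ℕ) : V → ℕ :=
  fun v => if v ∈ usedCenters c i then 1 else d v

/-- `T` is a directed Huffman tree for `⟨μ, d⟩` whose star sequence has centers
`c 0, …, c (q-1)` (so `S_i` has leaf set `children (c i)`): the centers enumerate the
internal vertices, the root is the last center, and at each of the first `q - 1` steps
the corresponding star is a minimal star of the current state. -/
def IsHuffmanSeq (μ : V → ℝ) (d : V → ℕ) (T : DirTree V) {q : ℕ} (c : Fin q → V) : Prop :=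
  (∀ v, T.deg v = d v) ∧
  Function.Injective c ∧
  (∀ v, 1 < d v ↔ ∃ j, c j = v) ∧
  (∀ hq : 0 < q, T.root = c ⟨q - 1, Nat.sub_lt hq Nat.one_pos⟩) ∧
  ∀ i : Fin q, (i : ℕ) < q - 1 →
    IsMinimalStar (stateV T c (i : ℕ)) (stateMu T μ c (i : ℕ)) (stateD d c (i : ℕ))
      (c i) (T.children (c i))

/-- `T ∈ ℛℋ(μ,d)`: `T` is a directed Huffman tree for `⟨μ, d⟩`. -/
def IsHuffmanDir (μ : V → ℝ) (d : V → ℕ) (T : DirTree V) : Prop :=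
  ∃ (q : ℕ) (c : Fin q → V), IsHuffmanSeq μ d T c

/-- Sum of the `k` smallest components of a multiset of reals. -/
def ascSum (s : Multiset ℝ) (k : ℕ) : ℝ := ((s.sort (· ≤ ·)).take k).sum

/-- `x` weakly majorizes `y` (`y ⪯^w x`). -/
def WMaj (x y : Multiset ℝ) : Prop :=
  Multiset.card x = Multiset.card y ∧ ∀ k, ascSum x k ≤ ascSum y k

/-- `x` strictly weakly majorizes `y` (`y ≺^w x`). -/
def SWMaj (x y : Multiset ℝ) : Prop := WMaj x y ∧ x ≠ y

namespace DirTree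

/-- Number of arcs on the directed path from a vertex to the root. -/
def depth (T : DirTree V) (u : V) : ℕ := Nat.find (T.reaches u)

theorem iterate_parent_root (T : DirTree V) (n : ℕ) : T.parent^[n] T.root = T.root :=
  Function.iterate_fixed T.parent_root n

theorem depth_eq_zero {T : DirTree V} {u : V} : T.depth u = 0 ↔ u = T.root := by
  simp [depth, Nat.find_eq_zero]

theorem depth_parent (T : DirTree V) (u : V) : T.depth (T.parent u) = T.depth u - 1 := by
  have hspec : T.parent^[T.depth u] u = T.root := Nat.find_spec (T.reaches u)
  have hspec' : T.parent^[T.depth (T.parent u)] (T.parent u) = T.root :=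
    Nat.find_spec (T.reaches (T.parent u))
  rw [← Function.iterate_succ_apply] at hspec'
  have h₁ : T.depth u ≤ T.depth (T.parent u) + 1 := Nat.find_min' (T.reaches u) hspec'
  have h₂ : T.depth (T.parent u) ≤ T.depth u - 1 := by
    refine Nat.find_min' (T.reaches (T.parent u)) ?_
    rcases h : T.depth u with _ | n
    · rw [depth_eq_zero.1 h, T.parent_root]
      exact T.iterate_parent_root _
    · rw [h, Function.iterate_succ_apply] at hspec
      simpa using hspec
  omega

theorem depth_iterate_parent (T : DirTree V) (n : ℕ) (u : V) :
    T.depth (T.parent^[n] u) = T.depth u - n := by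
  induction n with
  | zero => rfl
  | succ n ih => rw [Function.iterate_succ_apply', depth_parent, ih]; omega

theorem parent_ne_self {T : DirTree V} {u : V} (hu : u ≠ T.root) : T.parent u ≠ u := by
  intro h
  have h₁ := T.depth_parent u
  have h₂ : T.depth u ≠ 0 := mt depth_eq_zero.1 hu
  rw [h] at h₁
  omega

theorem mem_children {T : DirTree V} {u w : V} :
    u ∈ T.children w ↔ T.parent u = w ∧ u ≠ T.root := by
  simp only [children, Finset.mem_filter, Finset.mem_univ, true_and]
  constructor
  · rintro ⟨rfl, h⟩
    exact ⟨rfl, fun hu => h (by rw [hu, T.parent_root])⟩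
  · rintro ⟨rfl, h⟩
    exact ⟨rfl, (parent_ne_self h).symm⟩

theorem depth_of_mem_children {T : DirTree V} {u w : V} (h : u ∈ T.children w) :
    T.depth u = T.depth w + 1 := by
  obtain ⟨rfl, hu⟩ := mem_children.1 h
  have h₁ := T.depth_parent u
  have h₂ : T.depth u ≠ 0 := mt depth_eq_zero.1 hu
  omega

theorem filter_desc_eq (T : DirTree V) (w : V) :
    Finset.univ.filter (fun u => T.Desc u w) =
      insert w ((T.children w).biUnion fun c => Finset.univ.filter fun u => T.Desc u c) := by
  ext u
  simp only [Finset.mem_filter, Finset.mem_univ, true_and, Finset.mem_insert, Finset.mem_biUnion]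
  constructor
  · rintro ⟨n, hn⟩
    induction n with
    | zero => exact Or.inl hn
    | succ n ih =>
      rw [Function.iterate_succ_apply'] at hn
      by_cases hr : T.parent^[n] u = T.root
      · rw [hr, T.parent_root] at hn
        exact ih (hr.trans hn)
      · exact Or.inr ⟨_, mem_children.2 ⟨hn, hr⟩, n, rfl⟩
  · rintro (rfl | ⟨c, hc, n, rfl⟩)
    · exact ⟨0, rfl⟩
    · exact ⟨n + 1, by rw [Function.iterate_succ_apply', (mem_children.1 hc).1]⟩

theorem f_eq (T : DirTree V) (μ : V → ℝ) (w : V) :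
    T.f μ w = μ w + ∑ c ∈ T.children w, T.f μ c := by
  unfold f
  rw [filter_desc_eq, Finset.sum_insert, Finset.sum_biUnion]
  · intro c hc c' hc' hne
    refine Finset.disjoint_left.2 fun u hu hu' => hne ?_
    obtain ⟨n, hn⟩ := (Finset.mem_filter.1 hu).2
    obtain ⟨n', hn'⟩ := (Finset.mem_filter.1 hu').2
    have h := T.depth_iterate_parent n u
    have h' := T.depth_iterate_parent n' u
    rw [hn, depth_of_mem_children hc] at h
    rw [hn', depth_of_mem_children hc'] at h'
    have hnn : n = n' := by omega
    rw [← hn, ← hn', hnn]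
  · intro hw
    obtain ⟨c, hc, hwc⟩ := Finset.mem_biUnion.1 hw
    obtain ⟨n, hn⟩ := (Finset.mem_filter.1 hwc).2
    have h := T.depth_iterate_parent n w
    rw [hn, depth_of_mem_children hc] at h
    omega

theorem eq_f_of_forall_eq (T : DirTree V) (μ g : V → ℝ)
    (hg : ∀ w, g w = μ w + ∑ c ∈ T.children w, g c) : g = T.f μ := by
  have key : ∀ n w, Finset.univ.sup T.depth - T.depth w = n → g w = T.f μ w := by
    intro n
    induction n using Nat.strong_induction_on with
    | _ n ih =>
      intro w hw
      rw [hg, f_eq]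
      congr 1
      refine Finset.sum_congr rfl fun c hc => ih _ ?_ c rfl
      have h₁ := depth_of_mem_children hc
      have h₂ : T.depth c ≤ Finset.univ.sup T.depth := Finset.le_sup (Finset.mem_univ c)
      omega
  exact funext fun w => key _ w rfl

theorem card_children_lt_deg {T : DirTree V} {w : V} (hw : w ≠ T.root) :
    (T.children w).card < T.deg w := by
  simp [deg, hw]

theorem sum_children_count (T : DirTree V) (L : List V) (hL : T.root ∉ L) (w : V) :
    ∑ c ∈ T.children w, (L.count c : ℝ) = ((L.map T.parent).count w : ℝ) := by
  induction L with
  | nil => simp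
  | cons a L ih =>
    rw [List.mem_cons, not_or] at hL
    have ha : a ∈ T.children w ↔ T.parent a = w :=
      mem_children.trans (and_iff_left (Ne.symm hL.1))
    simp only [List.map_cons, List.count_cons, Nat.cast_add, Finset.sum_add_distrib, ih hL.2]
    simp [ha]

/-- The directed tree in which every vertex receives the parent of its image under a
permutation `σ` fixing the root, provided all vertices still reach the root. -/
def reparent (T : DirTree V) (σ : Equiv.Perm V) (hσ : σ T.root = T.root)
    (h : ∀ v, ∃ n, (T.parent ∘ σ)^[n] v = T.root) : DirTree V where
  root := T.root
  parent := T.parent ∘ σ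
  parent_root := by simp [hσ, T.parent_root]
  reaches := h

section Reparent

variable (T : DirTree V) (σ : Equiv.Perm V) (hσ : σ T.root = T.root)
  (h : ∀ v, ∃ n, (T.parent ∘ σ)^[n] v = T.root)

theorem map_children_reparent (w : V) :
    ((T.reparent σ hσ h).children w).map σ.toEmbedding = T.children w := by
  ext u
  simp only [Finset.mem_map, mem_children, Equiv.coe_toEmbedding]
  constructor
  · rintro ⟨c, ⟨h₁, h₂⟩, rfl⟩
    exact ⟨h₁, fun h₃ => h₂ (σ.injective (h₃.trans hσ.symm))⟩
  · rintro ⟨h₁, h₂⟩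
    refine ⟨σ.symm u, ⟨by simpa [reparent] using h₁, fun h₃ => h₂ ?_⟩, by simp⟩
    rw [← σ.apply_symm_apply u, h₃]
    exact hσ

theorem deg_reparent (w : V) : (T.reparent σ hσ h).deg w = T.deg w := by
  unfold deg
  rw [← T.map_children_reparent σ hσ h w, Finset.card_map]
  rfl

theorem sum_children_reparent (g : V → ℝ) (w : V) :
    ∑ c ∈ (T.reparent σ hσ h).children w, g c = ∑ c ∈ T.children w, g (σ.symm c) := by
  rw [← T.map_children_reparent σ hσ h w, Finset.sum_map]
  simp

end Reparent

end DirTree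

theorem map_eq_of_isChain_concat {α : Type*} {p : α → α} {a m : α} {L : List α}
    (h : ((a :: L) ++ [m]).IsChain fun a b => p a = b) : (a :: L).map p = L ++ [m] := by
  induction L generalizing a with
  | nil => simpa using h
  | cons b L ih =>
    rw [List.cons_append, List.cons_append, List.isChain_cons_cons] at h
    rw [List.map_cons, ih h.2, h.1, List.cons_append]

theorem forall_mem_of_map_eq {α : Type*} {p : α → α} {S : α → Prop}
    (hS : ∀ x, S (p x) → S x) {m : α} (hm : S m) {L : List α} {a : α}
    (h : (a :: L).map p = L ++ [m]) : ∀ x ∈ a :: L, S x := by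
  induction L generalizing a with
  | nil =>
    have ha : p a = m := by simpa using h
    intro x hx
    rw [List.mem_singleton.1 hx]
    exact hS a (ha ▸ hm)
  | cons b L ih =>
    rw [List.map_cons, List.cons_append, List.cons.injEq] at h
    have hb := ih h.2
    intro x hx
    rcases List.mem_cons.1 hx with rfl | hx
    · exact hS _ (h.1 ▸ hb b List.mem_cons_self)
    · exact hb x hx

theorem ascSum_ge (s : Multiset ℝ) {k : ℕ} (hk : k ≤ Multiset.card s) (t : ℝ) :
    k * t - (s.map fun x => max (t - x) 0).sum ≤ ascSum s k := by
  have hs : ((s.sort (· ≤ ·) : List ℝ) : Multiset ℝ) = s := Multiset.sort_eq s _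
  have hlen : (s.sort (· ≤ ·)).length = Multiset.card s := Multiset.length_sort _
  unfold ascSum
  conv_lhs => rw [← hs]
  generalize s.sort (· ≤ ·) = l at hlen
  rw [← hlen] at hk
  clear hs hlen
  rw [Multiset.map_coe, Multiset.sum_coe]
  induction k generalizing l with
  | zero =>
    simp only [Nat.cast_zero, zero_mul, List.take_zero, List.sum_nil, zero_sub, Left.neg_nonpos_iff]
    exact List.sum_nonneg fun x hx => by
      obtain ⟨y, -, rfl⟩ := List.mem_map.1 hx
      exact le_max_right _ _
  | succ k ih =>
    cases l with
    | nil => simp at hk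
    | cons a l =>
      have h₁ := ih l (by simpa using hk)
      have h₂ := le_max_left (t - a) 0
      simp only [List.map_cons, List.sum_cons, List.take_succ_cons]
      push_cast
      linarith

theorem exists_take_sum_eq {l : List ℝ} (hl : l.Pairwise (· ≤ ·)) {k : ℕ} (hk : k ≤ l.length) :
    ∃ t, (l.take k).sum = k * t - (l.map fun x => max (t - x) 0).sum := by
  rcases Nat.eq_zero_or_pos k with rfl | hk0
  · rcases l with _ | ⟨a, l⟩
    · exact ⟨0, by simp⟩
    · refine ⟨a, ?_⟩
      have h : ((a :: l).map fun x => max (a - x) 0).sum = 0 := by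
        refine List.sum_eq_zero fun y hy => ?_
        obtain ⟨x, hx, rfl⟩ := List.mem_map.1 hy
        rcases List.mem_cons.1 hx with rfl | hx
        · simp
        · exact max_eq_right (sub_nonpos.2 ((List.pairwise_cons.1 hl).1 x hx))
      rw [h]
      simp
  · refine ⟨l[k - 1], ?_⟩
    have hlt : k - 1 < l.length := by omega
    have h₁ : ∀ x ∈ l.take k, x ≤ l[k - 1] := by
      intro x hx
      obtain ⟨i, hi, rfl⟩ := List.mem_take_iff_getElem.1 hx
      rcases Nat.lt_or_ge i (k - 1) with h | h
      · exact List.pairwise_iff_getElem.1 hl _ _ _ _ h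
      · have : i = k - 1 := by omega
        subst this
        exact le_rfl
    have h₂ : ∀ x ∈ l.drop k, l[k - 1] ≤ x := by
      intro x hx
      obtain ⟨i, hi, rfl⟩ := List.mem_drop_iff_getElem.1 hx
      exact List.pairwise_iff_getElem.1 hl _ _ _ _ (by omega)
    generalize l[k - 1] = t at h₁ h₂
    have hd : ((l.drop k).map fun x => max (t - x) 0).sum = 0 := by
      refine List.sum_eq_zero fun y hy => ?_
      obtain ⟨x, hx, rfl⟩ := List.mem_map.1 hy
      exact max_eq_right (sub_nonpos.2 (h₂ x hx))
    have ht : ((l.take k).map fun x => max (t - x) 0).sum = k * t - (l.take k).sum := by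
      rw [List.map_congr_left (g := fun x => t - x)
        fun x hx => max_eq_left (sub_nonneg.2 (h₁ x hx))]
      simpa [hk] using Multiset.sum_map_sub (m := ((l.take k : List ℝ) : Multiset ℝ))
        (f := fun _ => t) (g := fun x => x)
    have hsplit : (l.map fun x => max (t - x) 0).sum =
        ((l.take k).map fun x => max (t - x) 0).sum +
          ((l.drop k).map fun x => max (t - x) 0).sum := by
      rw [← List.sum_append, ← List.map_append, List.take_append_drop]
    rw [hsplit, hd, ht]
    ring

theorem exists_ascSum_eq (s : Multiset ℝ) {k : ℕ} (hk : k ≤ Multiset.card s) :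
    ∃ t, ascSum s k = k * t - (s.map fun x => max (t - x) 0).sum := by
  obtain ⟨t, ht⟩ := exists_take_sum_eq (l := s.sort (· ≤ ·)) (Multiset.pairwise_sort s _)
    (k := k) (by simpa using hk)
  refine ⟨t, ht.trans ?_⟩
  rw [← Multiset.sum_coe, ← Multiset.map_coe, Multiset.sort_eq]

theorem ascSum_of_card_le (s : Multiset ℝ) {k : ℕ} (hk : Multiset.card s ≤ k) :
    ascSum s k = ascSum s (Multiset.card s) := by
  unfold ascSum
  rw [List.take_of_length_le (by simpa using hk), List.take_of_length_le (by simp)]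

/-- Weak majorization follows from the comparison of all sums `∑ max (t - x) 0`. -/
theorem WMaj.of_forall_sum_le {x y : Multiset ℝ} (hc : Multiset.card x = Multiset.card y)
    (h : ∀ t : ℝ, (y.map fun z => max (t - z) 0).sum ≤ (x.map fun z => max (t - z) 0).sum) :
    WMaj x y := by
  have key : ∀ k ≤ Multiset.card x, ascSum x k ≤ ascSum y k := by
    intro k hk
    obtain ⟨t, ht⟩ := exists_ascSum_eq x hk
    have h₁ := ascSum_ge y (hc ▸ hk) t
    have h₂ := h t
    linarith
  refine ⟨hc, fun k => ?_⟩
  rcases le_total k (Multiset.card x) with hk | hk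
  · exact key k hk
  · rw [ascSum_of_card_le x hk, ascSum_of_card_le y (hc ▸ hk), ← hc]
    exact key _ le_rfl

theorem max_sub_pair_le (t : ℝ) {x y δ : ℝ} (hxy : x ≤ y) (hδ : 0 ≤ δ) :
    0 ≤ (max (t - (x - δ)) 0 - max (t - x) 0) + (max (t - (y + δ)) 0 - max (t - y) 0) := by
  rcases max_cases (t - (x - δ)) 0 with h₁ | h₁ <;> rcases max_cases (t - x) 0 with h₂ | h₂ <;>
  rcases max_cases (t - (y + δ)) 0 with h₃ | h₃ <;> rcases max_cases (t - y) 0 with h₄ | h₄ <;>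
  linarith

theorem sum_max_sub_lists_nonneg {α : Type*} (F : α → ℝ) (t : ℝ) {δ : ℝ} (hδ : 0 ≤ δ)
    (L L' : List α) (hlen : L'.length ≤ L.length)
    (h : ∀ (i : ℕ) (hi : i < L'.length), F (L[i]'(hi.trans_le hlen)) ≤ F L'[i]) :
    0 ≤ (L.map fun x => max (t - (F x - δ)) 0 - max (t - F x) 0).sum +
      (L'.map fun x => max (t - (F x + δ)) 0 - max (t - F x) 0).sum := by
  induction L' generalizing L with
  | nil =>
    simp only [List.map_nil, List.sum_nil, add_zero]
    refine List.sum_nonneg fun y hy => ?_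
    obtain ⟨x, -, rfl⟩ := List.mem_map.1 hy
    exact sub_nonneg.2 (max_le_max (by linarith) le_rfl)
  | cons b L' ih =>
    cases L with
    | nil => simp at hlen
    | cons a L =>
      have h₁ := ih L (by simpa using hlen) fun i hi => h (i + 1) (Nat.succ_lt_succ hi)
      have h₂ := max_sub_pair_le t (h 0 (by simp)) hδ
      simp only [List.getElem_cons_zero] at h₂
      simp only [List.map_cons, List.sum_cons]
      linarith

theorem DirTree.exists_iterate_of_mem {T : DirTree V} {m a : V} {L : List V}
    (h : (a :: L).map T.parent = L ++ [m]) {x : V} (hx : x ∈ a :: L) :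
    ∃ n, T.parent^[n] x = m :=
  forall_mem_of_map_eq (S := fun x => ∃ n, T.parent^[n] x = m)
    (fun _ ⟨n, hn⟩ => ⟨n + 1, hn⟩) ⟨0, rfl⟩ h x hx

theorem DirTree.ne_root_of_iterate_eq {T : DirTree V} {x m : V} {n : ℕ}
    (hn : T.parent^[n] x = m) (hxm : x ≠ m) : x ≠ T.root := by
  rintro rfl
  exact hxm ((T.iterate_parent_root n).symm.trans hn)

theorem DirTree.iterate_ne_of_iterate_eq {T : DirTree V} {x m : V} {n : ℕ}
    (hn : T.parent^[n] x = m) (hxm : x ≠ m) (k : ℕ) : T.parent^[k] m ≠ x := by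
  intro hk
  have h₁ := T.depth_iterate_parent n x
  have h₂ := T.depth_iterate_parent k m
  rw [hn] at h₁
  rw [hk] at h₂
  rcases Nat.eq_zero_or_pos (T.depth x) with h | h
  · exact ne_root_of_iterate_eq hn hxm (depth_eq_zero.1 h)
  · have hk0 : k = 0 := by omega
    subst hk0
    exact hxm hk.symm

/-- The permutation exchanging `a` with `a'` and `b` with `b'`. -/
def doubleSwap {α : Type*} [DecidableEq α] (a a' b b' : α) : Equiv.Perm α :=
  Equiv.swap a a' * Equiv.swap b b'

section DoubleSwap

variable {α : Type*} [DecidableEq α] {a a' b b' : α}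

theorem doubleSwap_of_ne {x : α} (h₁ : x ≠ a) (h₂ : x ≠ a') (h₃ : x ≠ b) (h₄ : x ≠ b') :
    doubleSwap a a' b b' x = x := by
  rw [doubleSwap, Equiv.Perm.mul_apply, Equiv.swap_apply_of_ne_of_ne h₃ h₄,
    Equiv.swap_apply_of_ne_of_ne h₁ h₂]

theorem doubleSwap_values (hab : a ≠ b) (hab' : a ≠ b') (ha'b : a' ≠ b) (ha'b' : a' ≠ b') :
    doubleSwap a a' b b' a = a' ∧ doubleSwap a a' b b' a' = a ∧
    doubleSwap a a' b b' b = b' ∧ doubleSwap a a' b b' b' = b := by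
  simp only [doubleSwap, Equiv.Perm.mul_apply]
  refine ⟨?_, ?_, ?_, ?_⟩
  · rw [Equiv.swap_apply_of_ne_of_ne hab hab', Equiv.swap_apply_left]
  · rw [Equiv.swap_apply_of_ne_of_ne ha'b ha'b', Equiv.swap_apply_right]
  · rw [Equiv.swap_apply_left, Equiv.swap_apply_of_ne_of_ne hab'.symm ha'b'.symm]
  · rw [Equiv.swap_apply_right, Equiv.swap_apply_of_ne_of_ne hab.symm ha'b.symm]

theorem doubleSwap_symm_apply (hab : a ≠ b) (hab' : a ≠ b') (ha'b : a' ≠ b) (ha'b' : a' ≠ b')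
    (x : α) :
    (doubleSwap a a' b b').symm x = doubleSwap a a' b b' x := by
  obtain ⟨h₁, h₂, h₃, h₄⟩ := doubleSwap_values hab hab' ha'b ha'b'
  rw [Equiv.symm_apply_eq]
  by_cases ha : x = a
  · rw [ha, h₁, h₂]
  by_cases ha' : x = a'
  · rw [ha', h₂, h₁]
  by_cases hb : x = b
  · rw [hb, h₃, h₄]
  by_cases hb' : x = b'
  · rw [hb', h₄, h₃]
  rw [doubleSwap_of_ne ha ha' hb hb', doubleSwap_of_ne ha ha' hb hb']

end DoubleSwap

/-- given disjoint paths `(v, m₁, …, m_k, m)` and `(v', m₁', …, m_l', m)`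
with `1 ≤ l ≤ k`, `f_T(v) < f_T(v')`, `f_T(m₁) = f_T(m₁')` and `f_T(m_i) ≤ f_T(m_i')` for
`i = 2, …, l`, some tree of `ℛ(μ,d)` has a vector of subordinate groups' weights that
strictly weakly majorizes that of `T`. -/
theorem exchange_lemma_two {V : Type} [Fintype V] [DecidableEq V]
    (μ : V → ℝ) (d : V → ℕ) (hgen : IsGenTuple μ d)
    (T : DirTree V) (hT : memR T d)
    (v v' m m₁ m₁' : V) (rest rest' : List V) (hm : 1 < d m)
    (hpath : ((v :: m₁ :: rest) ++ [m]).Chain' fun a b => T.parent a = b)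
    (hnodup : ((v :: m₁ :: rest) ++ [m]).Nodup)
    (hpath' : ((v' :: m₁' :: rest') ++ [m]).Chain' fun a b => T.parent a = b)
    (hnodup' : ((v' :: m₁' :: rest') ++ [m]).Nodup)
    (hdisj : (v :: m₁ :: rest).Disjoint (v' :: m₁' :: rest'))
    (hlk : (m₁' :: rest').length ≤ (m₁ :: rest).length)
    (hf : T.f μ v < T.f μ v')
    (hf1 : T.f μ m₁ = T.f μ m₁')
    (hmaj : ∀ i : ℕ, 1 ≤ i → ∀ hi : i < (m₁' :: rest').length,
      T.f μ ((m₁ :: rest).get ⟨i, lt_of_lt_of_le hi hlk⟩) ≤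
        T.f μ ((m₁' :: rest').get ⟨i, hi⟩)) :
    ∃ T' : DirTree V, memR T' d ∧ SWMaj (T'.fvec μ) (T.fvec μ) := by
  have hL : (v :: m₁ :: rest).map T.parent = m₁ :: rest ++ [m] := map_eq_of_isChain_concat hpath
  have hL' : (v' :: m₁' :: rest').map T.parent = m₁' :: rest' ++ [m] :=
    map_eq_of_isChain_concat hpath'
  have hmL : ∀ x ∈ v :: m₁ :: rest, x ≠ m := fun x hx =>
    (List.nodup_append.1 hnodup).2.2 x hx m (List.mem_singleton_self m)
  have hmL' : ∀ x ∈ v' :: m₁' :: rest', x ≠ m := fun x hx =>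
    (List.nodup_append.1 hnodup').2.2 x hx m (List.mem_singleton_self m)
  have hrL : ∀ x ∈ v :: m₁ :: rest, x ≠ T.root := fun x hx =>
    (DirTree.exists_iterate_of_mem hL hx).elim fun n hn =>
      DirTree.ne_root_of_iterate_eq hn (hmL x hx)
  have hrL' : ∀ x ∈ v' :: m₁' :: rest', x ≠ T.root := fun x hx =>
    (DirTree.exists_iterate_of_mem hL' hx).elim fun n hn =>
      DirTree.ne_root_of_iterate_eq hn (hmL' x hx)
  have hN := (List.nodup_append.1 hnodup).1
  have hN' := (List.nodup_append.1 hnodup').1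
  have hNN : (m₁ :: m₁' :: (rest ++ rest')).Nodup ∧ v ∉ m₁ :: rest ∧ v ∉ m₁' :: rest' ∧
      v' ∉ m₁ :: rest ∧ v' ∉ m₁' :: rest' ∧ v ≠ v' := by
    simp only [List.nodup_cons, List.nodup_append, List.mem_cons, List.mem_append,
      List.Disjoint] at hN hN' hdisj ⊢
    grind
  obtain ⟨hNd, hv, hvL', hv'L, hv', hvv'⟩ := hNN
  have hv₁ : v ≠ m₁ := fun h => hv (h ▸ List.mem_cons_self)
  have hv₁' : v ≠ m₁' := fun h => hvL' (h ▸ List.mem_cons_self)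
  have hv'₁ : v' ≠ m₁ := fun h => hv'L (h ▸ List.mem_cons_self)
  have hv'₁' : v' ≠ m₁' := fun h => hv' (h ▸ List.mem_cons_self)
  have hvr : v ∉ rest := fun h => hv (List.mem_cons_of_mem _ h)
  have hvr' : v ∉ rest' := fun h => hvL' (List.mem_cons_of_mem _ h)
  have hv'r : v' ∉ rest := fun h => hv'L (List.mem_cons_of_mem _ h)
  have hv'r' : v' ∉ rest' := fun h => hv' (List.mem_cons_of_mem _ h)
  have hmm : m₁ ≠ m₁' ∧ m₁ ∉ rest ∧ m₁ ∉ rest' ∧ m₁' ∉ rest ∧ m₁' ∉ rest' ∧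
      (rest ++ rest').Nodup := by
    simp only [List.nodup_cons, List.mem_cons, List.mem_append] at hNd
    tauto
  obtain ⟨hmm, hm₁r, hm₁r', hm₁'r, hm₁'r', hNr⟩ := hmm
  have hdr : ∀ x ∈ rest, x ∉ rest' := fun x hx hx' =>
    (List.nodup_append.1 hNr).2.2 x hx x hx' rfl
  have hNrest := (List.nodup_append.1 hNr).1
  have hNrest' := (List.nodup_append.1 hNr).2.1
  obtain ⟨σ, hσ⟩ : ∃ σ, σ = doubleSwap v v' m₁ m₁' := ⟨_, rfl⟩
  obtain ⟨hσv, hσv', hσm, hσm'⟩ := doubleSwap_values hv₁ hv₁' hv'₁ hv'₁'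
  have hσne : ∀ x, x ≠ v → x ≠ v' → x ≠ m₁ → x ≠ m₁' → σ x = x :=
    fun x h₁ h₂ h₃ h₄ => hσ ▸ doubleSwap_of_ne h₁ h₂ h₃ h₄
  have hσsymm : ∀ x, σ.symm x = σ x := fun x =>
    hσ ▸ doubleSwap_symm_apply hv₁ hv₁' hv'₁ hv'₁' x
  rw [← hσ] at hσv hσv' hσm hσm'
  have hvmem : v ∈ v :: m₁ :: rest := by simp
  have hmmem : m₁ ∈ v :: m₁ :: rest := by simp
  have hvmem' : v' ∈ v' :: m₁' :: rest' := by simp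
  have hmmem' : m₁' ∈ v' :: m₁' :: rest' := by simp
  have hσroot : σ T.root = T.root :=
    hσne _ (hrL _ hvmem).symm (hrL' _ hvmem').symm (hrL _ hmmem).symm (hrL' _ hmmem').symm
  have hσrest : ∀ x ∈ rest, σ x = x := fun x hx => hσne x (ne_of_mem_of_not_mem hx hvr)
    (ne_of_mem_of_not_mem hx hv'r) (ne_of_mem_of_not_mem hx hm₁r) (ne_of_mem_of_not_mem hx hm₁'r)
  have hσrest' : ∀ x ∈ rest', σ x = x := fun x hx => hσne x (ne_of_mem_of_not_mem hx hvr')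
    (ne_of_mem_of_not_mem hx hv'r') (ne_of_mem_of_not_mem hx hm₁r')
    (ne_of_mem_of_not_mem hx hm₁'r')
  have hreach_m : ∃ n, (T.parent ∘ σ)^[n] m = T.root := by
    obtain ⟨n, hn⟩ := T.reaches m
    refine ⟨n, Eq.trans ?_ hn⟩
    have hne : ∀ x, x ∈ v :: m₁ :: rest ∨ x ∈ v' :: m₁' :: rest' → ∀ k, T.parent^[k] m ≠ x := by
      rintro x (hx | hx)
      · obtain ⟨j, hj⟩ := DirTree.exists_iterate_of_mem hL hx
        exact DirTree.iterate_ne_of_iterate_eq hj (hmL x hx)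
      · obtain ⟨j, hj⟩ := DirTree.exists_iterate_of_mem hL' hx
        exact DirTree.iterate_ne_of_iterate_eq hj (hmL' x hx)
    clear hn
    induction n with
    | zero => rfl
    | succ n ih =>
      rw [Function.iterate_succ_apply', ih, Function.iterate_succ_apply', Function.comp_apply,
        hσne _ (hne _ (Or.inl hvmem) n) (hne _ (Or.inr hvmem') n) (hne _ (Or.inl hmmem) n)
          (hne _ (Or.inr hmmem') n)]
  have hstep : ∀ x, (∃ n, (T.parent ∘ σ)^[n] ((T.parent ∘ σ) x) = T.root) →
      ∃ n, (T.parent ∘ σ)^[n] x = T.root := fun x ⟨n, hn⟩ => ⟨n + 1, hn⟩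
  have hchain : (v' :: m₁ :: rest').map (T.parent ∘ σ) = m₁ :: rest' ++ [m] := by
    rw [List.map_cons, List.map_cons, List.cons_append, List.cons.injEq] at hL hL'
    rw [List.map_cons, List.map_cons, Function.comp_apply, Function.comp_apply, hσv', hσm, hL.1,
      List.map_congr_left (f := T.parent ∘ σ) (g := T.parent)
        fun x hx => congrArg T.parent (hσrest' x hx), hL'.2,
      List.cons_append]
  have hchain' : (v :: m₁' :: rest).map (T.parent ∘ σ) = m₁' :: rest ++ [m] := by
    rw [List.map_cons, List.map_cons, List.cons_append, List.cons.injEq] at hL hL'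
    rw [List.map_cons, List.map_cons, Function.comp_apply, Function.comp_apply, hσv, hσm', hL'.1,
      List.map_congr_left (f := T.parent ∘ σ) (g := T.parent)
        fun x hx => congrArg T.parent (hσrest x hx), hL.2,
      List.cons_append]
  have hreach : ∀ x, ∃ n, (T.parent ∘ σ)^[n] x = T.root := by
    have h₁ := forall_mem_of_map_eq (S := fun x => ∃ n, (T.parent ∘ σ)^[n] x = T.root)
      hstep hreach_m hchain
    have h₂ := forall_mem_of_map_eq (S := fun x => ∃ n, (T.parent ∘ σ)^[n] x = T.root)
      hstep hreach_m hchain'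
    intro x
    obtain ⟨n, hn⟩ := T.reaches x
    induction n generalizing x with
    | zero => exact ⟨0, hn⟩
    | succ n ih =>
      by_cases hx : x = v ∨ x = v' ∨ x = m₁ ∨ x = m₁'
      · rcases hx with rfl | rfl | rfl | rfl
        · exact h₂ _ (by simp)
        · exact h₁ _ (by simp)
        · exact h₁ _ (by simp)
        · exact h₂ _ (by simp)
      · push Not at hx
        refine hstep x ?_
        rw [Function.comp_apply, hσne x hx.1 hx.2.1 hx.2.2.1 hx.2.2.2]
        exact ih _ hn
  obtain ⟨δ, hδ⟩ : ∃ δ, δ = T.f μ v' - T.f μ v := ⟨_, rfl⟩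
  have hδ0 : 0 < δ := by linarith
  obtain ⟨g, hg⟩ : ∃ g : V → ℝ, g = fun w => T.f μ w + δ * (([m₁].count w : ℝ) - [m₁'].count w
      - rest.count w + rest'.count w) := ⟨_, rfl⟩
  have hg₁ : g m₁ = T.f μ m₁ + δ := by
    simp [hg, List.count_eq_zero_of_not_mem, hm₁r, hm₁r', List.count_singleton, hmm.symm]
  have hg₁' : g m₁' = T.f μ m₁' - δ := by
    simp [hg, List.count_eq_zero_of_not_mem, hm₁'r, hm₁'r', List.count_singleton, hmm]
    ring
  have hgr : ∀ x ∈ rest, g x = T.f μ x - δ := fun x hx => by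
    simp [hg, List.count_eq_zero_of_not_mem, hdr x hx, List.count_singleton,
      (ne_of_mem_of_not_mem hx hm₁r).symm, (ne_of_mem_of_not_mem hx hm₁'r).symm,
      List.count_eq_one_of_mem hNrest hx]
    ring
  have hgr' : ∀ x ∈ rest', g x = T.f μ x + δ := fun x hx => by
    have hxr : x ∉ rest := fun h => hdr x h hx
    simp [hg, List.count_eq_zero_of_not_mem, hxr, List.count_singleton,
      (ne_of_mem_of_not_mem hx hm₁r').symm, (ne_of_mem_of_not_mem hx hm₁'r').symm,
      List.count_eq_one_of_mem hNrest' hx]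
  have hgne : ∀ x, x ≠ m₁ → x ≠ m₁' → x ∉ rest → x ∉ rest' → g x = T.f μ x :=
    fun x h₁ h₂ h₃ h₄ => by
      simp [hg, List.count_eq_zero_of_not_mem, h₃, h₄, List.count_singleton, h₁.symm, h₂.symm]
  have hσg : ∀ c, g (σ.symm c) = T.f μ c + δ * (([v].count c : ℝ) - (m₁ :: rest).count c
      - [v'].count c + (m₁' :: rest').count c) := by
    intro c
    rw [hσsymm]
    by_cases h₁ : c = v
    · subst h₁
      rw [hσv, hgne v' hv'₁ hv'₁' hv'r hv'r', List.count_eq_zero_of_not_mem hv,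
        List.count_eq_zero_of_not_mem hvL']
      simp [hvv'.symm, hδ]
    by_cases h₂ : c = v'
    · subst h₂
      rw [hσv', hgne v hv₁ hv₁' hvr hvr', List.count_eq_zero_of_not_mem hv'L,
        List.count_eq_zero_of_not_mem hv']
      simp [hvv', hδ]
    by_cases h₃ : c = m₁
    · subst h₃
      rw [hσm, hg₁', ← hf1]
      simp [hv₁, hv'₁, hmm.symm,
        List.count_eq_zero_of_not_mem, hm₁r, hm₁r']
      ring
    by_cases h₄ : c = m₁'
    · subst h₄
      rw [hσm', hg₁, hf1]
      simp [hv₁', hv'₁', hmm,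
        List.count_eq_zero_of_not_mem, hm₁'r, hm₁'r']
    rw [hσne c h₁ h₂ h₃ h₄, hg]
    simp [Ne.symm h₁, Ne.symm h₂, Ne.symm h₃, Ne.symm h₄]
  refine ⟨T.reparent σ hσroot hreach,
    ⟨hT.1, fun w => (T.deg_reparent σ hσroot hreach w).trans (hT.2 w)⟩, ?_⟩
  have hfg : (T.reparent σ hσroot hreach).f μ = g := by
    refine (DirTree.eq_f_of_forall_eq _ μ g fun w => ?_).symm
    rw [DirTree.sum_children_reparent, Finset.sum_congr rfl fun c _ => hσg c,
      Finset.sum_add_distrib, ← Finset.mul_sum, Finset.sum_add_distrib, Finset.sum_sub_distrib,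
      Finset.sum_sub_distrib]
    rw [List.map_cons, List.cons_append, List.cons.injEq] at hL hL'
    rw [T.sum_children_count [v], T.sum_children_count [v'], T.sum_children_count (m₁ :: rest),
      T.sum_children_count (m₁' :: rest'), hL.2, hL'.2, List.map_singleton, List.map_singleton,
      hL.1, hL'.1, hg]
    · simp only [List.count_append, Nat.cast_add]
      rw [T.f_eq μ w]
      ring
    · exact fun h => hrL' _ (List.mem_cons_of_mem _ h) rfl
    · exact fun h => hrL _ (List.mem_cons_of_mem _ h) rfl
    · exact fun h => hrL' _ hvmem' (List.mem_singleton.1 h).symm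
    · exact fun h => hrL _ hvmem (List.mem_singleton.1 h).symm
  set I : Finset V := Finset.univ.filter fun w => 1 < T.deg w ∧ w ≠ T.root with hI
  have hvec : (T.reparent σ hσroot hreach).fvec μ = I.val.map g := by
    unfold DirTree.fvec
    rw [hfg]
    simp only [T.deg_reparent σ hσroot hreach, hI]
    rfl
  have hvecT : T.fvec μ = I.val.map (T.f μ) := rfl
  have hmemI : ∀ x ∈ m₁ :: m₁' :: (rest ++ rest'), x ∈ I := by
    have hin : ∀ (a : V) (L : List V), (a :: L).map T.parent = L ++ [m] →
        (∀ x ∈ a :: L, x ≠ T.root) → ∀ x ∈ L, x ∈ I := by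
      intro a L h hr x hx
      have hx' : x ∈ (a :: L).map T.parent := h ▸ List.mem_append_left _ hx
      obtain ⟨y, hy, hyx⟩ := List.mem_map.1 hx'
      have hxr := hr x (List.mem_cons_of_mem _ hx)
      have hpos := Finset.card_pos.2 ⟨y, DirTree.mem_children.2 ⟨hyx, hr y hy⟩⟩
      exact Finset.mem_filter.2 ⟨Finset.mem_univ _,
        lt_of_le_of_lt hpos (DirTree.card_children_lt_deg hxr), hxr⟩
    have h₁ := hin _ _ hL hrL
    have h₂ := hin _ _ hL' hrL'
    intro x hx
    simp only [List.mem_cons, List.mem_append] at hx h₁ h₂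
    rcases hx with h | h | h | h
    · exact h₁ x (Or.inl h)
    · exact h₂ x (Or.inl h)
    · exact h₁ x (Or.inr h)
    · exact h₂ x (Or.inr h)
  have hsum : ∀ t : ℝ, (max (t - (T.f μ m₁ + δ)) 0 - max (t - T.f μ m₁) 0) +
      (max (t - (T.f μ m₁ - δ)) 0 - max (t - T.f μ m₁) 0) ≤
      ((I.val.map g).map fun z => max (t - z) 0).sum -
        ((I.val.map (T.f μ)).map fun z => max (t - z) 0).sum := by
    intro t
    have hlists := sum_max_sub_lists_nonneg (T.f μ) t hδ0.le rest rest'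
      (Nat.le_of_succ_le_succ hlk) fun i hi => hmaj (i + 1) (by omega) (Nat.succ_lt_succ hi)
    have hI_sum : ((I.val.map g).map fun z => max (t - z) 0).sum -
        ((I.val.map (T.f μ)).map fun z => max (t - z) 0).sum =
        ∑ x ∈ I, (max (t - g x) 0 - max (t - T.f μ x) 0) := by
      rw [Finset.sum_sub_distrib, Multiset.map_map, Multiset.map_map]
      rfl
    rw [hI_sum, ← Finset.sum_subset
      (s₁ := (m₁ :: m₁' :: (rest ++ rest')).toFinset)
      (fun x hx => hmemI x (List.mem_toFinset.1 hx)), List.sum_toFinset _ hNd]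
    · simp only [List.map_cons, List.map_append, List.sum_cons, List.sum_append]
      rw [hg₁, hg₁', ← hf1, List.map_congr_left (l := rest)
          (g := fun x => max (t - (T.f μ x - δ)) 0 - max (t - T.f μ x) 0)
          fun x hx => by rw [hgr x hx],
        List.map_congr_left (l := rest')
          (g := fun x => max (t - (T.f μ x + δ)) 0 - max (t - T.f μ x) 0)
          fun x hx => by rw [hgr' x hx]]
      linarith
    · intro x _ hx
      simp only [List.mem_toFinset, List.mem_cons, List.mem_append, not_or] at hx
      rw [hgne x hx.1 hx.2.1 hx.2.2.1 hx.2.2.2, sub_self]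
  rw [hvec, hvecT]
  refine ⟨WMaj.of_forall_sum_le (by simp) fun t => ?_, fun heq => ?_⟩
  · have h₁ := hsum t
    have h₂ := max_sub_pair_le t (le_refl (T.f μ m₁)) hδ0.le
    linarith
  · have h₁ := hsum (T.f μ m₁)
    rw [heq, sub_self, sub_self, max_eq_right (by linarith : T.f μ m₁ - (T.f μ m₁ + δ) ≤ 0),
      max_eq_left (by linarith : 0 ≤ T.f μ m₁ - (T.f μ m₁ - δ)), max_self] at h₁
    linarith
end
end

section
/- Suppose a directed tree T ∈ ℛ(μ,d) contains the directed paths (v, m) and (v′, m₁′, …, m_l′, m) from vertices v, v′ ∈ V to some internal vertex m ∈ M, with l ≥ 1 and f_T(v) < f_T(v′). If the directed tree T′ is obtained from T by deleting the arcs vm and v′m₁′ and adding the arcs v′m and vm₁′, then T′ ∈ ℛ(μ,d) and f(T′) strictly weakly majorizes f(T), i.e., f(T′) ≻^w f(T). -/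
open scoped Classical
noncomputable section

variable {V : Type} [Fintype V] [DecidableEq V]

namespace DirTree

theorem Desc.refl (T : DirTree V) (u : V) : T.Desc u u := ⟨0, rfl⟩

theorem Desc.trans {T : DirTree V} {u v w : V} (h₁ : T.Desc u v) (h₂ : T.Desc v w) :
    T.Desc u w := by
  obtain ⟨a, rfl⟩ := h₁
  obtain ⟨b, rfl⟩ := h₂
  exact ⟨b + a, Function.iterate_add_apply _ _ _ _⟩

theorem desc_iff (T : DirTree V) (u w : V) : T.Desc u w ↔ u = w ∨ T.Desc (T.parent u) w := by
  constructor
  · rintro ⟨_ | n, h⟩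
    · exact Or.inl h
    · exact Or.inr ⟨n, h⟩
  · rintro (rfl | ⟨n, h⟩)
    · exact Desc.refl T u
    · exact ⟨n + 1, h⟩

theorem desc_root (T : DirTree V) (u : V) : T.Desc u T.root := T.reaches u

theorem desc_of_parent_eq {T : DirTree V} {u w : V} (h : T.parent u = w) : T.Desc u w := ⟨1, h⟩

theorem desc_root_left (T : DirTree V) (w : V) : T.Desc T.root w ↔ w = T.root := by
  constructor
  · rintro ⟨n, rfl⟩
    exact Function.iterate_fixed T.parent_root n
  · rintro rfl
    exact Desc.refl T _

theorem Desc.antisymm {T : DirTree V} {u w : V} (h₁ : T.Desc u w) (h₂ : T.Desc w u) :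
    u = w := by
  obtain ⟨a, rfl⟩ := h₁
  obtain ⟨b, hb⟩ := h₂
  rcases Nat.eq_zero_or_pos a with rfl | ha
  · rfl
  obtain ⟨N, hN⟩ := T.reaches u
  have hper : Function.IsPeriodicPt T.parent (b + a) u :=
    (Function.iterate_add_apply _ _ _ _).trans hb
  have hfix : T.parent^[(b + a) * N] u = u := hper.mul_const N
  have hle : N ≤ (b + a) * N := Nat.le_mul_of_pos_left N (by omega)
  have hu : u = T.root := by
    rw [← Nat.sub_add_cancel hle, Function.iterate_add_apply, hN,
      Function.iterate_fixed T.parent_root] at hfix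
    exact hfix.symm
  rw [hu, Function.iterate_fixed T.parent_root]

theorem desc_of_chain (T : DirTree V) {m : V} (l : List V) (a : V)
    (h : ((a :: l) ++ [m]).IsChain fun x y => T.parent x = y) :
    T.Desc a m ∧ ∀ w, T.Desc a w → w ∈ a :: l ∨ T.Desc m w := by
  induction l generalizing a with
  | nil =>
    have h' : T.parent a = m := by simpa using h
    refine ⟨desc_of_parent_eq h', fun w hw => ?_⟩
    rw [desc_iff, h'] at hw
    exact hw.imp (fun e => by simp [e]) id
  | cons b l ih =>
    simp only [List.cons_append, List.isChain_cons_cons] at h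
    obtain ⟨hbm, hb⟩ := ih b (by simpa using h.2)
    refine ⟨(desc_of_parent_eq h.1).trans hbm, fun w hw => ?_⟩
    rw [desc_iff, h.1] at hw
    rcases hw with rfl | hw
    · simp
    · exact (hb w hw).imp (List.mem_cons_of_mem _) id

/-- The vertices `w` with `Desc a w` but not `Desc m w` are those of the path from `a` up to,
but excluding, `m`. Exchanging the outbound arcs of `v` and `v'` alters only their groups. -/
theorem desc_exchange {T T' : DirTree V} {v v' m a : V} (hroot : T'.root = T.root)
    (hpar : T'.parent = Function.update (Function.update T.parent v a) v' m)
    (hv : T.parent v = m) (hv' : T.parent v' = a) (hvv' : v ≠ v')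
    (hv'a : v' ≠ a) (ham : T.Desc a m) (hav : ¬ T.Desc a v) (u w : V) :
    T'.Desc u w ↔ if T.Desc a w ∧ ¬ T.Desc m w
      then (T.Desc u w ∧ ¬ T.Desc u v') ∨ T.Desc u v else T.Desc u w := by
  have hmv : ¬ T.Desc m v := fun h => hav (ham.trans h)
  have hav' : ¬ T.Desc a v' := fun h => hv'a ((desc_of_parent_eq hv').antisymm h)
  have hT := T.desc_iff
  obtain ⟨n, hn⟩ := T'.reaches u
  induction n generalizing u with
  | zero =>
    obtain rfl : u = T'.root := hn
    have hmr := T.desc_root m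
    rw [desc_root_left, hroot, desc_root_left, desc_root_left, desc_root_left]
    have hvr : v ≠ T.root := fun h => hav (h ▸ T.desc_root a)
    split_ifs with hP
    · constructor
      · rintro rfl
        exact absurd hmr hP.2
      · rintro (h | h)
        · exact h.1
        · exact absurd h hvr
    · rfl
  | succ n ih =>
    refine (T'.desc_iff u w).trans ((or_congr_right (ih (T'.parent u) hn)).trans ?_)
    have hup : T.Desc m w → T.Desc a w := ham.trans
    by_cases h1 : u = v'
    · subst h1
      have hp : T'.parent u = m := by rw [hpar]; simp
      rw [hp]
      have h2 : ¬ T.Desc u v := by rw [hT, hv']; grind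
      have h3 := T.desc_iff u w
      rw [hv'] at h3
      have h4 := Desc.refl T u
      by_cases hP : T.Desc a w ∧ ¬ T.Desc m w
      · have : u ≠ w := by rintro rfl; exact hav' hP.1
        simp only [if_pos hP]; grind
      · simp only [if_neg hP]; grind
    · by_cases h2 : u = v
      · subst h2
        have hp : T'.parent u = a := by rw [hpar]; simp [h1]
        rw [hp]
        have h3 := T.desc_iff u w
        rw [hv] at h3
        have h4 := Desc.refl T u
        by_cases hP : T.Desc a w ∧ ¬ T.Desc m w
        · simp only [if_pos hP]; grind
        · simp only [if_neg hP]; grind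
      · have hp : T'.parent u = T.parent u := by rw [hpar]; simp [h1, h2]
        rw [hp]
        have h3 := T.desc_iff u w
        have h4 := T.desc_iff u v
        have h5 := T.desc_iff u v'
        by_cases hP : T.Desc a w ∧ ¬ T.Desc m w
        · have h6 : u = w → ¬ T.Desc u v' := by
            rintro rfl h
            exact hav' (hP.1.trans h)
          simp only [if_pos hP]; grind
        · simp only [if_neg hP]; grind

theorem deg_exchange {T T' : DirTree V} {v v' m a : V} (hroot : T'.root = T.root)
    (hpar : T'.parent = Function.update (Function.update T.parent v a) v' m)
    (hv : T.parent v = m) (hv' : T.parent v' = a) (hvv' : v ≠ v') (hvm : v ≠ m)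
    (hv'a : v' ≠ a) (hva : v ≠ a) (hv'm : v' ≠ m) (w : V) : T'.deg w = T.deg w := by
  have hpar' (u : V) : T'.parent u = T.parent (Equiv.swap v v' u) := by
    rw [hpar, Equiv.swap_apply_def]
    grind [Function.update_apply]
  unfold deg
  rw [hroot]
  congr 1
  refine Finset.card_equiv (Equiv.swap v v') fun u => ?_
  simp only [children, Finset.mem_filter, Finset.mem_univ, true_and, hpar',
    Equiv.swap_apply_def]
  grind

theorem one_lt_deg_parent {T : DirTree V} {u a : V} (h : T.parent u = a) (hua : u ≠ a)
    (ha : a ≠ T.root) : 1 < T.deg a := by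
  have : 0 < (T.children a).card := Finset.card_pos.2 ⟨u, by simp [children, h, hua]⟩
  simp only [deg, if_neg ha]
  omega

theorem f_exchange {T T' : DirTree V} {μ : V → ℝ} (hμ : ∀ x, 0 ≤ μ x) {v v' m a : V}
    (hroot : T'.root = T.root)
    (hpar : T'.parent = Function.update (Function.update T.parent v a) v' m)
    (hv : T.parent v = m) (hv' : T.parent v' = a) (hvv' : v ≠ v')
    (hv'a : v' ≠ a) (ham : T.Desc a m) (hav : ¬ T.Desc a v) (w : V) :
    if T.Desc a w ∧ ¬ T.Desc m w then T'.f μ w ≤ T.f μ w - T.f μ v' + T.f μ v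
      else T'.f μ w = T.f μ w := by
  have key u := desc_exchange hroot hpar hv hv' hvv' hv'a ham hav u w
  split_ifs with hP
  · simp only [if_pos hP] at key
    have hsub : Finset.univ.filter (fun u => T.Desc u v') ⊆
        Finset.univ.filter (fun u => T.Desc u w) :=
      Finset.monotone_filter_right _ fun u _ hu =>
        Desc.trans hu ((desc_of_parent_eq hv').trans hP.1)
    unfold f
    rw [← Finset.sum_sdiff_eq_sub hsub]
    refine le_trans (Finset.sum_le_sum_of_subset_of_nonneg ?_ fun x _ _ => hμ x)
      (le_of_le_of_eq (le_add_of_nonneg_right ?_) (Finset.sum_union_inter (f := μ)))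
    · intro u
      simp [key]
    · exact Finset.sum_nonneg fun x _ => hμ x
  · simp only [if_neg hP] at key
    simp only [f, key]

end DirTree

theorem sum_take_orderedInsert_le (a : ℝ) (l : List ℝ) (k : ℕ) :
    ((l.orderedInsert (· ≤ ·) a).take (k + 1)).sum ≤ a + (l.take k).sum := by
  induction l generalizing k with
  | nil => simp
  | cons c l ih =>
    rw [List.orderedInsert_cons]
    split_ifs with h
    · simp
    · cases k with
      | zero => simpa using (not_le.1 h).le
      | succ k =>
        have := ih k
        simp only [List.take_succ_cons, List.sum_cons] at this ⊢
        linarith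

theorem sum_take_insertionSort_le (l : List ℝ) (k : ℕ) :
    ((l.insertionSort (· ≤ ·)).take k).sum ≤ (l.take k).sum := by
  induction l generalizing k with
  | nil => simp
  | cons a l ih =>
    cases k with
    | zero => simp
    | succ k =>
      rw [List.insertionSort_cons, List.take_succ_cons, List.sum_cons]
      linarith [sum_take_orderedInsert_le a (l.insertionSort (· ≤ ·)) k, ih k]

theorem ascSum_coe_le_sum_take (l : List ℝ) (k : ℕ) :
    ascSum (l : Multiset ℝ) k ≤ (l.take k).sum := by
  have h : (l : Multiset ℝ).sort (· ≤ ·) = l.insertionSort (· ≤ ·) := by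
    refine List.Perm.eq_of_pairwise' (r := (· ≤ ·)) (Multiset.pairwise_sort _ _)
      (List.pairwise_insertionSort _ _) ?_
    exact (Multiset.coe_eq_coe.1 (Multiset.sort_eq _ _)).trans (List.perm_insertionSort _ _).symm
  rw [ascSum, h]
  exact sum_take_insertionSort_le l k

theorem ascSum_map_le_ascSum_map {ι : Type*} {s : Multiset ι} {g h : ι → ℝ}
    (hgh : ∀ i ∈ s, g i ≤ h i) (k : ℕ) : ascSum (s.map g) k ≤ ascSum (s.map h) k := by
  obtain ⟨L, hL, hs⟩ : ∃ L : List ι, (L : Multiset ι) = s ∧ L.map h = (s.map h).sort (· ≤ ·) := by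
    have h1 : (((s.map h).sort (· ≤ ·) : List ℝ) : Multiset ℝ) = s.map h := Multiset.sort_eq _ _
    generalize (s.map h).sort (· ≤ ·) = t at h1
    induction t generalizing s with
    | nil => exact ⟨[], by simpa [eq_comm] using h1, rfl⟩
    | cons a t ih =>
      obtain ⟨i, hi, rfl⟩ : ∃ i ∈ s, h i = a := by
        rw [← Multiset.mem_map, ← h1]; simp
      obtain ⟨r, rfl⟩ := Multiset.exists_cons_of_mem hi
      obtain ⟨L, rfl, rfl⟩ := ih (s := r) (fun j hj => hgh j (Multiset.mem_cons_of_mem hj))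
        (by simpa [← Multiset.cons_coe] using h1)
      exact ⟨i :: L, rfl, rfl⟩
  subst hL
  refine (ascSum_coe_le_sum_take (L.map g) k).trans ?_
  rw [ascSum, ← hs, ← List.map_take, ← List.map_take]
  exact List.sum_le_sum fun i hi => hgh i (List.mem_of_mem_take hi)

theorem sWMaj_map {ι : Type*} {s : Finset ι} {g h : ι → ℝ} (hgh : ∀ i ∈ s, g i ≤ h i)
    (hlt : ∃ i ∈ s, g i < h i) : SWMaj (s.val.map g) (s.val.map h) :=
  ⟨⟨by simp, ascSum_map_le_ascSum_map hgh⟩,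
    fun e => (Finset.sum_lt_sum hgh hlt).ne (congrArg Multiset.sum e)⟩

/-- given an arc `(v, m)` and a path `(v', m₁', …, m_l', m)` with `l ≥ 1`,
`f_T(v) < f_T(v')`, and `v` not on the second path, swapping the outbound arcs of `v`
and `v'` yields a tree of `ℛ(μ,d)` whose vector of subordinate groups' weights strictly
weakly majorizes that of `T`. -/
theorem exchange_lemma_three {V : Type} [Fintype V] [DecidableEq V]
    (μ : V → ℝ) (d : V → ℕ) (hgen : IsGenTuple μ d)
    (T : DirTree V) (hT : memR T d)
    (v v' m m₁' : V) (rest' : List V) (hm : 1 < d m)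
    (harc : T.parent v = m) (hvroot : v ≠ T.root)
    (hpath' : ((v' :: m₁' :: rest') ++ [m]).Chain' fun a b => T.parent a = b)
    (hnodup' : ((v' :: m₁' :: rest') ++ [m]).Nodup)
    (hdisj : v ∉ (v' :: m₁' :: rest') ++ [m])
    (hf : T.f μ v < T.f μ v')
    (T' : DirTree V) (hroot : T'.root = T.root)
    (hpar : T'.parent = Function.update (Function.update T.parent v m₁') v' m) :
    memR T' d ∧ SWMaj (T'.fvec μ) (T.fvec μ) := by
  obtain ⟨hv', hchain⟩ := List.isChain_cons_cons.1 hpath'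
  obtain ⟨ham, hmem⟩ := T.desc_of_chain rest' m₁' hchain
  simp only [List.cons_append, List.nodup_cons, List.mem_cons, List.mem_append, not_or,
    List.not_mem_nil, or_false] at hnodup' hdisj
  obtain ⟨⟨hv'a, -, hv'm⟩, ⟨-, ham'⟩, -⟩ := hnodup'
  obtain ⟨hvv', hva, hvrest, hvm⟩ := hdisj
  have hav : ¬ T.Desc m₁' v := fun h => (hmem v h).elim (by simp [hva, hvrest])
    fun h => hvm ((DirTree.desc_of_parent_eq harc).antisymm h)
  have hdeg := DirTree.deg_exchange hroot hpar harc hv' hvv' hvm hv'a hva hv'm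
  have hfw := DirTree.f_exchange hgen.nonneg hroot hpar harc hv' hvv' hv'a ham hav
  have hma : ¬ T.Desc m m₁' := fun h => ham' (ham.antisymm h)
  refine ⟨⟨hroot ▸ hT.1, fun w => (hdeg w).trans (hT.2 w)⟩, ?_⟩
  unfold DirTree.fvec
  simp only [hdeg, hroot]
  refine sWMaj_map (fun w _ => ?_) ⟨m₁', ?_, ?_⟩
  · have := hfw w
    split_ifs at this
    · linarith
    · exact this.le
  · have har : m₁' ≠ T.root := fun h => hma (h ▸ T.desc_root m)
    simpa using ⟨DirTree.one_lt_deg_parent hv' hv'a har, har⟩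
  · have := hfw m₁'
    rw [if_pos ⟨DirTree.Desc.refl T _, hma⟩] at this
    linarith
end
end
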